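/- arXiv:1806.05529 — 2 statements merged into one kernel-verified Lean document; each statement's English description precedes it below -/
import Mathlib

section
/- The derived subalgebra [C_{L_p}(h), C_{L_p}(h)] (the Lie subalgebra generated by all brackets of pairs of elements of C_{L_p}(h)) equals the K-linear span of the brackets [x, a_1 + a_2 + ⋯ + a_{p−1}] as x ranges over C_{L_p}(h). -/
namespace Paper

variable (K : Type) [Field K] (p : ℕ)

abbrev Idx (p : ℕ) : Type := (ZMod p)ˣ ⊕ (ZMod p)ˣ

/-- The Lie ideal of the free Lie algebra generated by the `v`-generators. -/
noncomputable def vIdealFree : LieIdeal K (FreeLieAlgebra K (Idx p)) :=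
  LieSubmodule.lieSpan K _ (Set.range fun i => FreeLieAlgebra.of K (Sum.inr i : Idx p))

noncomputable def rels : Set (FreeLieAlgebra K (Idx p)) :=
  { z : FreeLieAlgebra K (Idx p) | ∃ i j : (ZMod p)ˣ,
      z = ⁅FreeLieAlgebra.of K (Sum.inl i : Idx p), FreeLieAlgebra.of K (Sum.inl j : Idx p)⁆ } ∪
  { z : FreeLieAlgebra K (Idx p) | ∃ u ∈ vIdealFree K p, ∃ w ∈ vIdealFree K p, z = ⁅u, w⁆ }

noncomputable def relIdeal : LieIdeal K (FreeLieAlgebra K (Idx p)) :=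
  LieSubmodule.lieSpan K _ (rels K p)

abbrev Lp : Type := FreeLieAlgebra K (Idx p) ⧸ relIdeal K p

noncomputable def gen (x : Idx p) : Lp K p :=
  LieSubmodule.Quotient.mk (N := relIdeal K p) (FreeLieAlgebra.of K x)

noncomputable def aGen (i : (ZMod p)ˣ) : Lp K p := gen K p (Sum.inl i)
noncomputable def vGen (i : (ZMod p)ˣ) : Lp K p := gen K p (Sum.inr i)

/-- Left-normed bracket `[x, l₁, l₂, …]` in the generators. -/
noncomputable def lnb (x : Idx p) (l : List (Idx p)) : Lp K p :=
  l.foldl (fun b y => ⁅b, gen K p y⁆) (gen K p x)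

/-- Degree-`k` homogeneous component: the span of left-normed brackets of length `k`. -/
noncomputable def homog (k : ℕ) : Submodule K (Lp K p) :=
  Submodule.span K { z | ∃ x l, l.length + 1 = k ∧ z = lnb K p x l }

/-- Fixed-point subspace of a Lie algebra automorphism. -/
noncomputable def fixedSubmodule (e : Lp K p ≃ₗ⁅K⁆ Lp K p) : Submodule K (Lp K p) where
  carrier := { x | e x = x }
  add_mem' := by
    intro a b ha hb
    simp only [Set.mem_setOf_eq] at *
    rw [show e (a + b) = e a + e b from map_add e.toLinearEquiv a b, ha, hb]
  zero_mem' := by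
    simp only [Set.mem_setOf_eq]
    rw [show e 0 = 0 from map_zero e.toLinearEquiv]
  smul_mem' := by
    intro c a ha
    simp only [Set.mem_setOf_eq] at *
    rw [show e (c • a) = c • e a from map_smul e.toLinearEquiv c a, ha]

/-- Eigenspace of a Lie algebra automorphism for the eigenvalue `c`. -/
noncomputable def eigSp (e : Lp K p ≃ₗ⁅K⁆ Lp K p) (c : K) : Submodule K (Lp K p) where
  carrier := { x | e x = c • x }
  add_mem' := by
    intro a b ha hb
    simp only [Set.mem_setOf_eq] at *
    rw [show e (a + b) = e a + e b from map_add e.toLinearEquiv a b, ha, hb, smul_add]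
  zero_mem' := by
    simp only [Set.mem_setOf_eq]
    rw [show e 0 = 0 from map_zero e.toLinearEquiv, smul_zero]
  smul_mem' := by
    intro d a ha
    simp only [Set.mem_setOf_eq] at *
    rw [show e (d • a) = d • e a from map_smul e.toLinearEquiv d a, ha, smul_comm]


section

/-- The quotient map from the free Lie algebra to `Lp`, as a Lie algebra homomorphism. -/
noncomputable def mkHom : FreeLieAlgebra K (Idx p) →ₗ⁅K⁆ Lp K p where
  toFun := LieSubmodule.Quotient.mk (N := relIdeal K p)
  map_add' _ _ := rfl
  map_smul' _ _ := rfl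
  map_lie' := rfl

theorem mkHom_surjective : Function.Surjective (mkHom K p) :=
  LieSubmodule.Quotient.surjective_mk' _

theorem mkHom_eq_zero {z : FreeLieAlgebra K (Idx p)} (hz : z ∈ rels K p) : mkHom K p z = 0 :=
  LieSubmodule.Quotient.mk_eq_zero'.2 (LieSubmodule.subset_lieSpan hz)

theorem lie_aGen_aGen (i j : (ZMod p)ˣ) : ⁅aGen K p i, aGen K p j⁆ = 0 :=
  mkHom_eq_zero K p (Or.inl ⟨i, j, rfl⟩)

/-- The Lie ideal of `Lp` generated by the `v`-generators. -/
noncomputable def vIdeal : LieIdeal K (Lp K p) := (vIdealFree K p).map (mkHom K p)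

theorem vGen_mem_vIdeal (i : (ZMod p)ˣ) : vGen K p i ∈ vIdeal K p :=
  LieIdeal.mem_map (f := mkHom K p) (LieSubmodule.subset_lieSpan ⟨i, rfl⟩)

theorem lie_eq_zero_of_mem_vIdeal {x y : Lp K p} (hx : x ∈ vIdeal K p) (hy : y ∈ vIdeal K p) :
    ⁅x, y⁆ = 0 := by
  obtain ⟨⟨u, hu⟩, rfl⟩ := LieIdeal.mem_map_of_surjective (mkHom_surjective K p) hx
  obtain ⟨⟨w, hw⟩, rfl⟩ := LieIdeal.mem_map_of_surjective (mkHom_surjective K p) hy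
  rw [← LieHom.map_lie]
  exact mkHom_eq_zero K p (Or.inr ⟨u, hu, w, hw, rfl⟩)

/-- A subalgebra of `Lp` containing the generators is everything. -/
theorem mem_of_gen_mem (S : LieSubalgebra K (Lp K p)) (hS : ∀ x, gen K p x ∈ S) (z : Lp K p) :
    z ∈ S := by
  obtain ⟨u, rfl⟩ := mkHom_surjective K p z
  have key : S.incl.comp (FreeLieAlgebra.lift K fun x => (⟨gen K p x, hS x⟩ : S)) = mkHom K p :=
    FreeLieAlgebra.hom_ext fun x => by
      rw [LieHom.comp_apply, FreeLieAlgebra.lift_of_apply]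
      rfl
  rw [← key]
  exact (FreeLieAlgebra.lift K (fun x => (⟨gen K p x, hS x⟩ : S)) u).2

section Coordinates

attribute [local instance] LieRing.ofAssociativeRing

theorem relIdeal_le_ker_lift (f : Idx p → K) : relIdeal K p ≤ (FreeLieAlgebra.lift K f).ker := by
  rw [relIdeal, LieSubmodule.lieSpan_le]
  rintro _ (⟨i, j, rfl⟩ | ⟨u, -, w, -, rfl⟩) <;>
    simp [LieRing.of_associative_ring_bracket, mul_comm]

/-- The linear functional on `Lp` that vanishes on brackets and takes prescribed values on the
generators. -/
noncomputable def functional (f : Idx p → K) : Lp K p →ₗ[K] K :=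
  Submodule.liftQ (relIdeal K p).toSubmodule (FreeLieAlgebra.lift K f).toLinearMap
    fun _ hz => relIdeal_le_ker_lift K p f hz

theorem functional_gen (f : Idx p → K) (x : Idx p) : functional K p f (gen K p x) = f x :=
  FreeLieAlgebra.lift_of_apply f x

theorem functional_lie (f : Idx p → K) (x y : Lp K p) : functional K p f ⁅x, y⁆ = 0 := by
  obtain ⟨u, rfl⟩ := mkHom_surjective K p x
  obtain ⟨w, rfl⟩ := mkHom_surjective K p y
  change FreeLieAlgebra.lift K f ⁅u, w⁆ = 0
  rw [LieHom.map_lie, LieRing.of_associative_ring_bracket, mul_comm, sub_self]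

end Coordinates

theorem linearMap_ext_of_gen {φ ψ : Lp K p →ₗ[K] K} (hφ : ∀ x y : Lp K p, φ ⁅x, y⁆ = 0)
    (hψ : ∀ x y : Lp K p, ψ ⁅x, y⁆ = 0) (hgen : ∀ x, φ (gen K p x) = ψ (gen K p x)) : φ = ψ := by
  let S : LieSubalgebra K (Lp K p) :=
    { LinearMap.eqLocus φ ψ with
      lie_mem' := fun {x y} _ _ => (hφ x y).trans (hψ x y).symm }
  exact LinearMap.ext (mem_of_gen_mem K p S hgen)

variable [Fact p.Prime]

/-- The coefficient of `aGen i`. -/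
noncomputable def coeff (i : (ZMod p)ˣ) : Lp K p →ₗ[K] K :=
  functional K p (Sum.elim (Pi.single i 1) 0)

theorem lie_sum_aGen_sum_aGen (c d : (ZMod p)ˣ → K) :
    ⁅∑ i, c i • aGen K p i, ∑ i, d i • aGen K p i⁆ = 0 := by
  simp [sum_lie, lie_sum, lie_aGen_aGen]

theorem sub_sum_coeff_smul_aGen_mem_vIdeal (x : Lp K p) :
    x - ∑ i, coeff K p i x • aGen K p i ∈ vIdeal K p := by
  let T : Lp K p →ₗ[K] Lp K p :=
    LinearMap.id - ∑ i, (coeff K p i).smulRight (aGen K p i)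
  have hT (x : Lp K p) : T x = x - ∑ i, coeff K p i x • aGen K p i := by simp [T]
  let S : LieSubalgebra K (Lp K p) :=
    { (vIdeal K p).toSubmodule.comap T with
      lie_mem' := by
        intro x y hx hy
        change T x ∈ vIdeal K p at hx
        change T y ∈ vIdeal K p at hy
        change T ⁅x, y⁆ ∈ vIdeal K p
        rw [hT] at hx hy
        have hxy : T ⁅x, y⁆ = ⁅x, y⁆ := by simp [hT, coeff, functional_lie]
        have hsplit : ⁅x, y⁆ = ⁅x, y - ∑ i, coeff K p i y • aGen K p i⁆
            + ⁅x - ∑ i, coeff K p i x • aGen K p i, ∑ i, coeff K p i y • aGen K p i⁆ := by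
          rw [lie_sub, sub_lie, lie_sum_aGen_sum_aGen]
          abel
        rw [hxy, hsplit]
        exact add_mem (lie_mem_right K _ _ _ _ hy) (lie_mem_left K _ _ _ _ hx) }
  rw [← hT]
  refine mem_of_gen_mem K p S ?_ x
  rintro (j | j)
  · change T (aGen K p j) ∈ vIdeal K p
    have : T (aGen K p j) = 0 := by
      simp [hT, coeff, aGen, functional_gen, Pi.single_apply]
    rw [this]
    exact zero_mem _
  · change T (vGen K p j) ∈ vIdeal K p
    have : T (vGen K p j) = vGen K p j := by
      simp [hT, coeff, vGen, functional_gen]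
    rw [this]
    exact vGen_mem_vIdeal K p j

theorem coeff_map (r : (ZMod p)ˣ) (h : Lp K p ≃ₗ⁅K⁆ Lp K p)
    (hha : ∀ i : (ZMod p)ˣ, h (aGen K p i) = aGen K p (r * i))
    (hhv : ∀ i : (ZMod p)ˣ, h (vGen K p i) = vGen K p (r * i)) (i : (ZMod p)ˣ) (x : Lp K p) :
    coeff K p (r * i) (h x) = coeff K p i x := by
  have key : (coeff K p (r * i)).comp (h.toLinearEquiv : Lp K p →ₗ[K] Lp K p) = coeff K p i := by
    refine linearMap_ext_of_gen K p (fun x y => ?_) (fun x y => functional_lie K p _ x y) ?_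
    · change coeff K p (r * i) (h ⁅x, y⁆) = 0
      rw [LieEquiv.map_lie]
      exact functional_lie K p _ _ _
    · rintro (j | j)
      · change coeff K p (r * i) (h (aGen K p j)) = coeff K p i (aGen K p j)
        rw [hha]
        simp [coeff, aGen, functional_gen, Pi.single_apply]
      · change coeff K p (r * i) (h (vGen K p j)) = coeff K p i (vGen K p j)
        rw [hhv]
        simp [coeff, vGen, functional_gen]
  exact LinearMap.congr_fun key x

theorem sum_aGen_mem_fixedSubmodule (r : (ZMod p)ˣ) (h : Lp K p ≃ₗ⁅K⁆ Lp K p)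
    (hha : ∀ i : (ZMod p)ˣ, h (aGen K p i) = aGen K p (r * i)) :
    ∑ i, aGen K p i ∈ fixedSubmodule K p h := by
  change h.toLinearEquiv (∑ i, aGen K p i) = _
  rw [map_sum]
  exact (Finset.sum_congr rfl fun i _ => hha i).trans (Equiv.sum_comp (Equiv.mulLeft r) (aGen K p))

/-- A fixed point is, modulo a fixed point in the ideal generated by the `v`-generators, a scalar
multiple of the sum of the `a`-generators. -/
theorem exists_sub_smul_mem_vIdeal (r : (ZMod p)ˣ) (hr : Subgroup.zpowers r = ⊤)
    (h : Lp K p ≃ₗ⁅K⁆ Lp K p)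
    (hha : ∀ i : (ZMod p)ˣ, h (aGen K p i) = aGen K p (r * i))
    (hhv : ∀ i : (ZMod p)ˣ, h (vGen K p i) = vGen K p (r * i))
    {x : Lp K p} (hx : x ∈ fixedSubmodule K p h) :
    ∃ s : K, ∃ v ∈ vIdeal K p, v ∈ fixedSubmodule K p h ∧
      x = s • ∑ i, aGen K p i + v := by
  have hstep (i : (ZMod p)ˣ) : coeff K p (r * i) x = coeff K p i x := by
    have hxx : h x = x := hx
    conv_lhs => rw [← hxx]
    exact coeff_map K p r h hha hhv i x
  have hconst (i : (ZMod p)ˣ) : coeff K p i x = coeff K p 1 x := by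
    obtain ⟨n, rfl⟩ := (mem_powers_iff_mem_zpowers.2 (hr ▸ Subgroup.mem_top i) :
      i ∈ Submonoid.powers r)
    induction n with
    | zero => simp
    | succ n ih => simpa only [pow_succ', hstep] using ih
  refine ⟨coeff K p 1 x, x - coeff K p 1 x • ∑ i, aGen K p i, ?_,
    sub_mem hx (Submodule.smul_mem _ _ (sum_aGen_mem_fixedSubmodule K p r h hha)), by abel⟩
  simpa [hconst, Finset.smul_sum] using sub_sum_coeff_smul_aGen_mem_vIdeal K p x

end

/-- **Generators of the derived subalgebra of `C_{L_p}(h)`.**  The Lie subalgebra generated by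
all brackets of pairs of elements of `C_{L_p}(h)` equals the linear span of the brackets
`⁅x, a_1 + a_2 + ⋯ + a_{p−1}⁆` as `x` ranges over `C_{L_p}(h)`. -/
theorem derived_fixed_h_eq_span (K : Type) [Field K] (p : ℕ) [Fact p.Prime]
    (hchar : ¬ (ringChar K ∣ p)) (ω : K) (hω : IsPrimitiveRoot ω p)
    (r : (ZMod p)ˣ) (hr : Subgroup.zpowers r = ⊤)
    (h : Lp K p ≃ₗ⁅K⁆ Lp K p)
    (hha : ∀ i : (ZMod p)ˣ, h (aGen K p i) = aGen K p (r * i))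
    (hhv : ∀ i : (ZMod p)ˣ, h (vGen K p i) = vGen K p (r * i)) :
    (LieSubalgebra.lieSpan K (Lp K p)
        { z : Lp K p | ∃ x ∈ fixedSubmodule K p h, ∃ y ∈ fixedSubmodule K p h,
            z = ⁅x, y⁆ }).toSubmodule
      = Submodule.span K
          { z : Lp K p | ∃ x ∈ fixedSubmodule K p h,
              z = ⁅x, ∑ i : (ZMod p)ˣ, aGen K p i⁆ } := by
  set α := ∑ i : (ZMod p)ˣ, aGen K p i with hα
  have hαfix : α ∈ fixedSubmodule K p h := sum_aGen_mem_fixedSubmodule K p r h hha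
  set M := Submodule.span K { z : Lp K p | ∃ x ∈ fixedSubmodule K p h, z = ⁅x, α⁆ } with hM
  have hMV : M ≤ (vIdeal K p).toSubmodule := by
    rw [hM, Submodule.span_le]
    rintro _ ⟨x, hx, rfl⟩
    obtain ⟨s, v, hv, -, rfl⟩ := exists_sub_smul_mem_vIdeal K p r hr h hha hhv hx
    rw [add_lie, smul_lie, lie_self, smul_zero, zero_add]
    exact lie_mem_left K _ _ _ _ hv
  apply le_antisymm
  · let S : LieSubalgebra K (Lp K p) :=
      { M with
        lie_mem' := fun {x y} hx hy => by
          rw [lie_eq_zero_of_mem_vIdeal K p (hMV hx) (hMV hy)]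
          exact M.zero_mem }
    suffices LieSubalgebra.lieSpan K (Lp K p)
        { z : Lp K p | ∃ x ∈ fixedSubmodule K p h, ∃ y ∈ fixedSubmodule K p h, z = ⁅x, y⁆ } ≤ S
      from this
    rw [LieSubalgebra.lieSpan_le]
    rintro _ ⟨x, hx, y, hy, rfl⟩
    obtain ⟨s, v, hv, hvfix, rfl⟩ := exists_sub_smul_mem_vIdeal K p r hr h hha hhv hx
    obtain ⟨t, w, hw, hwfix, rfl⟩ := exists_sub_smul_mem_vIdeal K p r hr h hha hhv hy
    refine Submodule.subset_span ⟨t • v - s • w,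
      sub_mem (Submodule.smul_mem _ _ hvfix) (Submodule.smul_mem _ _ hwfix), ?_⟩
    rw [add_lie, lie_add, lie_add, lie_eq_zero_of_mem_vIdeal K p hv hw, ← hα, sub_lie,
      smul_lie, smul_lie, smul_lie, smul_lie, lie_smul, lie_smul, lie_self, ← lie_skew α w]
    simp only [smul_zero, smul_neg]
    abel
  · rw [hM, Submodule.span_le]
    rintro _ ⟨x, hx, rfl⟩
    exact LieSubalgebra.subset_lieSpan ⟨x, hx, α, hαfix, rfl⟩

end Paper
end

section
/- Let T_p = I_p + J_p, and let h̄ denote the Lie algebra automorphism of the quotient L̄_p = L_p/T_p induced by h (which is well defined since T_p is h-invariant). Then the fixed-point subspace of h̄ in L̄_p equals the image of C_{L_p}(h) under the quotient map, i.e. C_{L̄_p}(h̄) = (C_{L_p}(h) + T_p)/T_p; this holds without any coprimality assumption between the characteristic of K and p−1. -/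
namespace Paper

variable (K : Type) [Field K] (p : ℕ)

/-- The Lie ideal of `L_p` generated by the fixed-point subspace of `f`. -/
noncomputable def Ip (K : Type) [Field K] (p : ℕ) (f : Lp K p ≃ₗ⁅K⁆ Lp K p) :
    LieIdeal K (Lp K p) :=
  LieSubmodule.lieSpan K (Lp K p) (fixedSubmodule K p f : Set (Lp K p))

/-- The derived subalgebra of the fixed-point subspace of `h`. -/
noncomputable def derivedFixed (K : Type) [Field K] (p : ℕ) (h : Lp K p ≃ₗ⁅K⁆ Lp K p) :
    LieSubalgebra K (Lp K p) :=
  LieSubalgebra.lieSpan K (Lp K p)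
    { z : Lp K p | ∃ x ∈ fixedSubmodule K p h, ∃ y ∈ fixedSubmodule K p h, z = ⁅x, y⁆ }

/-- `J_p`: the smallest Lie ideal of `L_p` containing `[C_{L_p}(h), C_{L_p}(h)]` and invariant
under both `f` and `h`. -/
noncomputable def Jp (K : Type) [Field K] (p : ℕ) (f h : Lp K p ≃ₗ⁅K⁆ Lp K p) :
    LieIdeal K (Lp K p) :=
  sInf { J : LieIdeal K (Lp K p) |
    (∀ z ∈ derivedFixed K p h, z ∈ J) ∧ (∀ x ∈ J, f x ∈ J) ∧ (∀ x ∈ J, h x ∈ J) }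

/-- The fixed-point subspace of a Lie algebra automorphism of an arbitrary Lie algebra. -/
noncomputable def fixedPts (K : Type) [Field K] {L : Type} [LieRing L] [LieAlgebra K L]
    (e : L ≃ₗ⁅K⁆ L) : Submodule K L where
  carrier := { x | e x = x }
  add_mem' := by
    intro a b ha hb
    simp only [Set.mem_setOf_eq] at *
    rw [show e (a + b) = e a + e b from map_add e.toLinearEquiv a b, ha, hb]
  zero_mem' := by
    simp only [Set.mem_setOf_eq]
    rw [show e 0 = 0 from map_zero e.toLinearEquiv]
  smul_mem' := by
    intro c a ha
    simp only [Set.mem_setOf_eq] at *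
    rw [show e (c • a) = c • e a from map_smul e.toLinearEquiv c a, ha]

section EigenProjection

variable {F V : Type*} [Field F] [AddCommGroup V] [Module F V] {n : ℕ} [NeZero n]

/-- The Fourier projection onto the `ψ j`-eigenspace of an action `Φ` of `ZMod n`. -/
noncomputable def eigProj (ψ : AddChar (ZMod n) F) (Φ : AddChar (ZMod n) (Module.End F V))
    (j : ZMod n) : Module.End F V :=
  (n : F)⁻¹ • ∑ k, ψ (-(j * k)) • Φ k

theorem sum_eigProj (hn : (n : F) ≠ 0) {ψ : AddChar (ZMod n) F} (hψ : ψ.IsPrimitive)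
    (Φ : AddChar (ZMod n) (Module.End F V)) : ∑ j, eigProj ψ Φ j = 1 := by
  have key (k : ZMod n) : ∑ j, ψ (-(j * k)) = if k = 0 then (n : F) else 0 := by
    have := AddChar.sum_mulShift (-k) hψ
    simpa [mul_neg, ZMod.card, apply_ite] using this
  simp only [eigProj, ← Finset.smul_sum]
  rw [Finset.sum_comm]
  simp only [← Finset.sum_smul, key, ite_smul, zero_smul, Finset.sum_ite_eq',
    Finset.mem_univ, if_true, AddChar.map_zero_eq_one]
  rw [smul_smul, inv_mul_cancel₀ hn, one_smul]

theorem mul_eigProj_zero (ψ : AddChar (ZMod n) F) (Φ : AddChar (ZMod n) (Module.End F V))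
    (a : ZMod n) : Φ a * eigProj ψ Φ 0 = eigProj ψ Φ 0 := by
  simp only [eigProj, zero_mul, neg_zero, AddChar.map_zero_eq_one, one_smul, mul_smul_comm,
    Finset.mul_sum, ← AddChar.map_add_eq_mul]
  congr 1
  exact Fintype.sum_equiv (Equiv.addLeft a) _ _ fun _ => rfl

theorem eigProj_mem (ψ : AddChar (ZMod n) F) (Φ : AddChar (ZMod n) (Module.End F V))
    {T : Submodule F V} (hT : ∀ k, ∀ x ∈ T, Φ k x ∈ T) (j : ZMod n) {x : V} (hx : x ∈ T) :
    eigProj ψ Φ j x ∈ T := by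
  simp only [eigProj, LinearMap.smul_apply, LinearMap.sum_apply]
  exact T.smul_mem _ (T.sum_mem fun k _ => T.smul_mem _ (hT k x hx))

theorem mul_eigProj (ψ : AddChar (ZMod n) F) (Φ : AddChar (ZMod n) (Module.End F V))
    {h : Module.End F V} {r : (ZMod n)ˣ} (hΦ : ∀ k, Φ k * h = h * Φ (r * k)) (j : ZMod n) :
    h * eigProj ψ Φ j = eigProj ψ Φ (r * j) * h := by
  simp only [eigProj, mul_smul_comm, smul_mul_assoc, Finset.mul_sum, Finset.sum_mul, hΦ]
  congr 1
  refine (Fintype.sum_equiv r.mulLeft _ _ fun k => ?_).symm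
  simp only [Units.mulLeft_apply]
  congr 3
  ring

/-- If `h` permutes the eigenspaces of `f` like multiplication by a generator of `(ZMod n)ˣ`, and
a `f`- and `h`-invariant submodule `T` contains the eigenspaces with non-unit index, then every
element fixed by `h` modulo `T` is congruent modulo `T` to an element fixed by `h`. -/
theorem exists_fixed_sub_mem {p : ℕ} [Fact p.Prime] (hp : (p : F) ≠ 0)
    {ω : F} (hω : IsPrimitiveRoot ω p) {r : (ZMod p)ˣ} (hr : Subgroup.zpowers r = ⊤)
    {f h : Module.End F V} (hf : f ^ p = 1) (hh : h ^ orderOf r = 1)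
    (hfh : f * h = h * f ^ (r : ZMod p).val) {T : Submodule F V}
    (hfT : ∀ x ∈ T, f x ∈ T) (hhT : ∀ x ∈ T, h x ∈ T) (hfix : ∀ x, f x = x → x ∈ T)
    {x : V} (hx : h x - x ∈ T) : ∃ y, h y = y ∧ x - y ∈ T := by
  have hpow {g : Module.End F V} (hg : ∀ x ∈ T, g x ∈ T) (k : ℕ) : ∀ x ∈ T, (g ^ k) x ∈ T := by
    induction k with
    | zero => simp
    | succ k ih => intro x hx; rw [pow_succ]; exact ih _ (hg x hx)
  let ψ : AddChar (ZMod p) F := AddChar.zmodChar p hω.pow_eq_one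
  have hψ : ψ.IsPrimitive := AddChar.zmodChar_primitive_of_primitive_root p hω
  let Φ : AddChar (ZMod p) (Module.End F V) :=
    { toFun := fun k => f ^ k.val
      map_zero_eq_one' := by simp
      map_add_eq_mul' := fun a b => by
        rw [ZMod.val_add, ← pow_eq_pow_mod _ hf, pow_add] }
  have hΦ_apply (k : ZMod p) : Φ k = f ^ k.val := rfl
  have hΦ (k : ZMod p) : Φ k * h = h * Φ (r * k) := by
    have hm (m : ℕ) : f ^ m * h = h * (f ^ (r : ZMod p).val) ^ m := by
      induction m with
      | zero => simp
      | succ m ih => rw [pow_succ, mul_assoc, hfh, ← mul_assoc, ih, mul_assoc, ← pow_succ]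
    rw [hΦ_apply, hΦ_apply, hm, ← pow_mul, ZMod.val_mul, ← pow_eq_pow_mod _ hf]
  let P := eigProj ψ Φ
  have hP (k : ℕ) : h ^ k * P 1 = P ((r ^ k : (ZMod p)ˣ) : ZMod p) * h ^ k := by
    induction k with
    | zero => simp
    | succ k ih =>
      rw [pow_succ', mul_assoc, ih, ← mul_assoc, mul_eigProj ψ Φ hΦ, mul_assoc, pow_succ' r,
        Units.val_mul]
  have hP0 : P 0 x ∈ T := hfix _ <| by
    have h1 : Φ 1 = f := by
      rw [hΦ_apply, ZMod.val_one, pow_one]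
    rw [← Module.End.mul_apply, ← h1, mul_eigProj_zero]
  have hhx (k : ℕ) : (h ^ k) x - x ∈ T := by
    induction k with
    | zero => simp
    | succ k ih =>
      rw [pow_succ', Module.End.mul_apply]
      have := T.add_mem (hhT _ ih) hx
      rwa [map_sub, sub_add_sub_cancel] at this
  have hsum : x = P 0 x + ∑ k ∈ Finset.range (orderOf r),
      P ((r ^ k : (ZMod p)ˣ) : ZMod p) x := by
    have h1 : ∑ k ∈ Finset.range (orderOf r), P ((r ^ k : (ZMod p)ˣ) : ZMod p) x
        = ∑ u : (ZMod p)ˣ, P (u : ZMod p) x := by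
      rw [← IsCyclic.image_range_orderOf (a := r) (by simp [hr]), Finset.sum_image]
      intro a ha b hb hab
      exact pow_injOn_Iio_orderOf (by simpa using ha) (by simpa using hb) hab
    have h2 : ∑ j, P j x = x := by
      rw [← LinearMap.sum_apply, sum_eigProj hp hψ, Module.End.one_apply]
    have h3 : ∑ j ∈ {0}ᶜ, P j x = ∑ u : (ZMod p)ˣ, P (u : ZMod p) x :=
      (Finset.sum_bij (s := Finset.univ) (t := {0}ᶜ) (fun (u : (ZMod p)ˣ) _ => (u : ZMod p))
        (fun u _ => by simp) (fun u _ v _ huv => Units.ext huv)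
        (fun j hj => ⟨Units.mk0 j (by simpa using hj), Finset.mem_univ _, rfl⟩)
        fun _ _ => rfl).symm
    rw [h1, ← h3, ← Fintype.sum_eq_add_sum_compl 0 fun j => P j x, h2]
  refine ⟨∑ k ∈ Finset.range (orderOf r), (h ^ k) (P 1 x), ?_, ?_⟩
  · simp only [map_sum, ← Module.End.mul_apply, ← mul_assoc, ← pow_succ']
    rw [← sub_eq_zero, ← Finset.sum_sub_distrib, Finset.sum_range_sub
      (fun k => (h ^ k * P 1) x)]
    simp [hh]
  · nth_rewrite 1 [hsum]
    rw [add_sub_assoc, ← Finset.sum_sub_distrib]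
    refine T.add_mem hP0 (T.sum_mem fun k _ => ?_)
    rw [← Module.End.mul_apply, hP, Module.End.mul_apply, ← map_sub, ← neg_mem_iff, ← map_neg,
      neg_sub]
    exact eigProj_mem ψ Φ (fun k => hpow hfT _) _ (hhx k)

end EigenProjection

section Generators

variable {K p}

/-- Lie algebra homomorphisms out of `L_p` are determined by their values on the generators. -/
theorem Lp.hom_ext {M : Type*} [LieRing M] [LieAlgebra K M] {φ χ : Lp K p →ₗ⁅K⁆ M}
    (h : ∀ x, φ (gen K p x) = χ (gen K p x)) : φ = χ := by
  let π : FreeLieAlgebra K (Idx p) →ₗ⁅K⁆ Lp K p :=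
    { (LieSubmodule.Quotient.mk' (relIdeal K p)).toLinearMap with map_lie' := rfl }
  have hπ : φ.comp π = χ.comp π := FreeLieAlgebra.hom_ext h
  ext z
  obtain ⟨z, rfl⟩ := LieSubmodule.Quotient.surjective_mk' _ z
  exact LieHom.congr_fun hπ z

theorem exists_lieHom_pow {L : Type*} [LieRing L] [LieAlgebra K L] (φ : L →ₗ⁅K⁆ L) (n : ℕ) :
    ∃ χ : L →ₗ⁅K⁆ L, (χ : Module.End K L) = (φ : Module.End K L) ^ n := by
  induction n with
  | zero => exact ⟨LieHom.id, rfl⟩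
  | succ n ih =>
    obtain ⟨χ, hχ⟩ := ih
    exact ⟨χ.comp φ, by rw [pow_succ, ← hχ]; rfl⟩

variable {f h : Lp K p ≃ₗ⁅K⁆ Lp K p}

/-- Linear endomorphisms of `L_p` that underlie Lie algebra homomorphisms agree once they agree
on the generators. -/
theorem Lp.end_ext {φ χ : Module.End K (Lp K p)} (hφ : ∃ φ' : Lp K p →ₗ⁅K⁆ Lp K p, φ' = φ)
    (hχ : ∃ χ' : Lp K p →ₗ⁅K⁆ Lp K p, χ' = χ) (h : ∀ x, φ (gen K p x) = χ (gen K p x)) :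
    φ = χ := by
  obtain ⟨φ, rfl⟩ := hφ
  obtain ⟨χ, rfl⟩ := hχ
  exact congrArg _ (Lp.hom_ext h)

theorem Ip_map_mem {x : Lp K p} (hx : x ∈ Ip K p f) : f x ∈ Ip K p f := by
  induction hx using LieSubmodule.lieSpan_induction with
  | mem x hx =>
    have hfx : f x = x := hx
    rw [hfx]
    exact LieSubmodule.subset_lieSpan hx
  | zero => rw [map_zero]; exact zero_mem _
  | add x y _ _ hx hy => rw [map_add]; exact add_mem hx hy
  | smul c x _ hx => rw [map_smul]; exact (Ip K p f).smul_mem c hx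
  | lie x y _ hy => rw [LieEquiv.map_lie]; exact (Ip K p f).lie_mem hy

theorem Jp_map_mem {x : Lp K p} (hx : x ∈ Jp K p f h) : f x ∈ Jp K p f h := by
  rw [Jp, ← LieSubmodule.mem_toSubmodule, LieSubmodule.sInf_toSubmodule_eq_iInf] at hx ⊢
  simp only [Submodule.mem_iInf] at hx ⊢
  exact fun J hJ => hJ.2.1 x (hx J hJ)

theorem Ip_sup_Jp_map_mem {x : Lp K p} (hx : x ∈ Ip K p f ⊔ Jp K p f h) :
    f x ∈ Ip K p f ⊔ Jp K p f h := by
  obtain ⟨y, hy, z, hz, rfl⟩ := (LieSubmodule.mem_sup _ _ _).1 hx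
  rw [map_add]
  exact (LieSubmodule.mem_sup _ _ _).2 ⟨_, Ip_map_mem hy, _, Jp_map_mem hz, rfl⟩

end Generators

/-- **Lemma 5.2.**  Let `T_p = I_p + J_p` and let `h̄` be the automorphism of
`L̄_p = L_p/T_p` induced by `h`.  Then `C_{L̄_p}(h̄) = (C_{L_p}(h) + T_p)/T_p`; no coprimality
between the characteristic of `K` and `p − 1` is assumed. -/
theorem fixed_points_quotient_covered (K : Type) [Field K] (p : ℕ) [Fact p.Prime]
    (hchar : ¬ (ringChar K ∣ p)) (ω : K) (hω : IsPrimitiveRoot ω p)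
    (r : (ZMod p)ˣ) (hr : Subgroup.zpowers r = ⊤)
    (f h : Lp K p ≃ₗ⁅K⁆ Lp K p)
    (hfa : ∀ i : (ZMod p)ˣ, f (aGen K p i) = ω ^ ((i : ZMod p)).val • aGen K p i)
    (hfv : ∀ i : (ZMod p)ˣ, f (vGen K p i) = ω ^ ((i : ZMod p)).val • vGen K p i)
    (hha : ∀ i : (ZMod p)ˣ, h (aGen K p i) = aGen K p (r * i))
    (hhv : ∀ i : (ZMod p)ˣ, h (vGen K p i) = vGen K p (r * i))
    (hbar : (Lp K p ⧸ (Ip K p f ⊔ Jp K p f h)) ≃ₗ⁅K⁆ (Lp K p ⧸ (Ip K p f ⊔ Jp K p f h)))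
    (hcompat : ∀ x : Lp K p,
      hbar (LieSubmodule.Quotient.mk' (Ip K p f ⊔ Jp K p f h) x)
        = LieSubmodule.Quotient.mk' (Ip K p f ⊔ Jp K p f h) (h x)) :
    fixedPts K hbar
      = Submodule.map (LieSubmodule.Quotient.mk' (Ip K p f ⊔ Jp K p f h)).toLinearMap
          (fixedSubmodule K p h ⊔ (Ip K p f ⊔ Jp K p f h).toSubmodule) := by
  let f' : Module.End K (Lp K p) := (f : Lp K p →ₗ⁅K⁆ Lp K p)
  let h' : Module.End K (Lp K p) := (h : Lp K p →ₗ⁅K⁆ Lp K p)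
  have hfg (x : Idx p) : f' (gen K p x)
      = ω ^ ((Sum.elim id id x : (ZMod p)ˣ) : ZMod p).val • gen K p x := by
    rcases x with i | i
    exacts [hfa i, hfv i]
  have hhg (x : Idx p) : h' (gen K p x) = gen K p (Sum.map (r * ·) (r * ·) x) := by
    rcases x with i | i
    exacts [hha i, hhv i]
  have hfpow (n : ℕ) (x : Idx p) : (f' ^ n) (gen K p x)
      = (ω ^ ((Sum.elim id id x : (ZMod p)ˣ) : ZMod p).val) ^ n • gen K p x := by
    induction n with
    | zero => simp
    | succ n ih => rw [pow_succ, Module.End.mul_apply, hfg, map_smul, ih, smul_smul, pow_succ']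
  have hhpow (n : ℕ) (x : Idx p) :
      (h' ^ n) (gen K p x) = gen K p (Sum.map (r ^ n * ·) (r ^ n * ·) x) := by
    induction n with
    | zero => rcases x with i | i <;> simp
    | succ n ih =>
      rw [pow_succ', Module.End.mul_apply, ih, hhg, Sum.map_map]
      simp only [Function.comp_def, ← mul_assoc, ← pow_succ']
  have hfp : f' ^ p = 1 := Lp.end_ext (exists_lieHom_pow _ _) ⟨LieHom.id, rfl⟩ fun x => by
    rw [hfpow, ← pow_mul, mul_comm, pow_mul, hω.pow_eq_one, one_pow, one_smul,
      Module.End.one_apply]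
  have hhr : h' ^ orderOf r = 1 := Lp.end_ext (exists_lieHom_pow _ _) ⟨LieHom.id, rfl⟩ fun x => by
    rw [hhpow, pow_orderOf_eq_one]
    rcases x with i | i <;> simp
  have hfh : f' * h' = h' * f' ^ (r : ZMod p).val := by
    obtain ⟨χ, hχ⟩ := exists_lieHom_pow (f : Lp K p →ₗ⁅K⁆ Lp K p) (r : ZMod p).val
    refine Lp.end_ext ⟨(f : Lp K p →ₗ⁅K⁆ Lp K p).comp (h : Lp K p →ₗ⁅K⁆ Lp K p), rfl⟩
      ⟨(h : Lp K p →ₗ⁅K⁆ Lp K p).comp χ, by rw [← hχ]; rfl⟩ fun x => ?_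
    rw [Module.End.mul_apply, Module.End.mul_apply, hhg, hfg, hfpow, map_smul, hhg, ← pow_mul]
    congr 1
    rcases x with i | i <;>
      simp only [Sum.map_inl, Sum.map_inr, Sum.elim_inl, Sum.elim_inr, id, Units.val_mul,
        ZMod.val_mul, ← pow_eq_pow_mod _ hω.pow_eq_one, mul_comm]
  have hp0 : (p : K) ≠ 0 := fun hp => hchar (ringChar.dvd hp)
  let T := Ip K p f ⊔ Jp K p f h
  have hhT (x : Lp K p) (hx : x ∈ T) : h x ∈ T := by
    refine (LieSubmodule.Quotient.mk_eq_zero _).1 ?_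
    rw [← hcompat, (LieSubmodule.Quotient.mk_eq_zero _).2 hx, map_zero]
  ext z
  constructor
  · intro hz
    obtain ⟨x, rfl⟩ := LieSubmodule.Quotient.surjective_mk' T z
    have hx : h x - x ∈ T := by
      refine (LieSubmodule.Quotient.mk_eq_zero _).1 ?_
      rw [map_sub, ← hcompat, sub_eq_zero]
      exact hz
    obtain ⟨y, hy, hxy⟩ := exists_fixed_sub_mem (T := T.toSubmodule) hp0 hω hr hfp hhr hfh
      (fun x hx => Ip_sup_Jp_map_mem hx) hhT
      (fun x hx => (le_sup_left : Ip K p f ≤ T) (LieSubmodule.subset_lieSpan hx)) hx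
    exact ⟨x, Submodule.mem_sup.2 ⟨y, hy, x - y, hxy, add_sub_cancel _ _⟩, rfl⟩
  · rintro ⟨x, hx, rfl⟩
    obtain ⟨y, hy, t, ht, rfl⟩ := Submodule.mem_sup.1 hx
    have hy' : h y = y := hy
    have ht' : LieSubmodule.Quotient.mk' T t = 0 := (LieSubmodule.Quotient.mk_eq_zero _).2 ht
    change hbar (LieSubmodule.Quotient.mk' T (y + t)) = LieSubmodule.Quotient.mk' T (y + t)
    rw [map_add, ht', add_zero, hcompat, hy']

end Paper
end
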